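/- Let {γ_ij : i,j ∈ ℕ} ⊂ K ∪ {0} be a family of gain functions that is pointwise equicontinuous: for every r ≥ 0 and ε > 0 there exists δ = δ(r,ε) > 0 such that for all r̃ ∈ ℝ₊ with |r − r̃| ≤ δ one has |γ_ij(r) − γ_ij(r̃)| ≤ ε for all i,j ∈ ℕ. Then the gain operator Γ, defined on the positive cone ℓ∞⁺ of bounded nonnegative real sequences by Γ(s) := (sup_{j∈ℕ} γ_ij(s_j))_{i∈ℕ}, is well-defined (i.e., Γ(s) ∈ ℓ∞⁺ for every s ∈ ℓ∞⁺) and continuous with respect to the supremum norm. -/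

import Mathlib

open NNReal Set

noncomputable section

/-- Comparison class `K`: continuous, strictly increasing functions `ℝ₊ → ℝ₊` vanishing at `0`. -/
def ClassK (γ : ℝ≥0 → ℝ≥0) : Prop :=
  Continuous γ ∧ StrictMono γ ∧ γ 0 = 0

/-- A nonnegative sequence `s` belongs to the positive cone `ℓ∞⁺` iff it is bounded. -/
def MemLinfPlus (s : ℕ → ℝ≥0) : Prop :=
  BddAbove (range s)

/-- The gain operator `Γ(s) = (sup_{j} γ_{ij}(s_j))_{i ∈ ℕ}` on `ℓ∞⁺`. -/
def gainOp (γ : ℕ → ℕ → ℝ≥0 → ℝ≥0) (s : ℕ → ℝ≥0) : ℕ → ℝ≥0 :=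
  fun i => ⨆ j : ℕ, γ i j (s j)

/-- If the family of gains `{γ_ij} ⊂ K ∪ {0}` is pointwise equicontinuous, then the gain
operator `Γ(s) = (sup_j γ_ij(s_j))_i` is well-defined on the positive cone `ℓ∞⁺` of
bounded nonnegative sequences (each supremum is finite and `Γ(s)` is bounded) and `Γ` is
continuous with respect to the supremum norm. -/
theorem gain_operator_well_defined_and_continuous
    (γ : ℕ → ℕ → ℝ≥0 → ℝ≥0)
    (hclass : ∀ i j : ℕ, ClassK (γ i j) ∨ γ i j = fun _ => 0)
    (hequi : ∀ r : ℝ≥0, ∀ ε : ℝ≥0, 0 < ε → ∃ δ : ℝ≥0, 0 < δ ∧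
      ∀ r' : ℝ≥0, dist r r' ≤ (δ : ℝ) →
        ∀ i j : ℕ, dist (γ i j r) (γ i j r') ≤ (ε : ℝ)) :
    -- well-definedness: `Γ` maps `ℓ∞⁺` into `ℓ∞⁺`
    (∀ s : ℕ → ℝ≥0, MemLinfPlus s →
      (∀ i : ℕ, BddAbove (range fun j : ℕ => γ i j (s j))) ∧
      MemLinfPlus (gainOp γ s)) ∧
    -- continuity with respect to the supremum norm
    (∀ s : ℕ → ℝ≥0, MemLinfPlus s → ∀ ε : ℝ≥0, 0 < ε → ∃ δ : ℝ≥0, 0 < δ ∧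
      ∀ s' : ℕ → ℝ≥0, MemLinfPlus s' →
        (∀ i : ℕ, dist (s i) (s' i) ≤ (δ : ℝ)) →
        ∀ i : ℕ, dist (gainOp γ s i) (gainOp γ s' i) ≤ (ε : ℝ)) := by
  have hmono : ∀ i j, Monotone (γ i j) := by
    intro i j
    rcases hclass i j with h | h
    · exact h.2.1.monotone
    · rw [h]; exact monotone_const
  have hzero : ∀ i j, γ i j 0 = 0 := by
    intro i j
    rcases hclass i j with h | h
    · exact h.2.2
    · rw [h]
  -- uniform boundedness at each radius, by connectedness
  have hbdd : ∀ r : ℝ≥0, ∃ C : ℝ≥0, ∀ i j, γ i j r ≤ C := by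
    have hle : ∀ a b c : ℝ≥0, dist a b ≤ ((1 : ℝ≥0) : ℝ) → a ≤ c → b ≤ c + 1 := by
      intro a b c hab hac
      rw [NNReal.dist_eq, abs_le] at hab
      rw [← NNReal.coe_le_coe] at hac ⊢
      push_cast at hab ⊢
      linarith [hab.1]
    have hclopen : IsClopen {r : ℝ≥0 | ∃ C : ℝ≥0, ∀ i j, γ i j r ≤ C} := by
      constructor
      · rw [← isOpen_compl_iff, Metric.isOpen_iff]
        intro r hr
        obtain ⟨δ, hδ, h⟩ := hequi r 1 one_pos
        refine ⟨δ, by exact_mod_cast hδ, ?_⟩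
        rintro r' hr' ⟨C, hC⟩
        refine hr ⟨C + 1, fun i j => hle (γ i j r') _ _ ?_ (hC i j)⟩
        rw [dist_comm]
        exact h r' (by rw [dist_comm]; exact (Metric.mem_ball.1 hr').le) i j
      · rw [Metric.isOpen_iff]
        rintro r ⟨C, hC⟩
        obtain ⟨δ, hδ, h⟩ := hequi r 1 one_pos
        refine ⟨δ, by exact_mod_cast hδ, ?_⟩
        intro r' hr'
        refine ⟨C + 1, fun i j => hle (γ i j r) _ _ ?_ (hC i j)⟩
        exact h r' (by rw [dist_comm]; exact (Metric.mem_ball.1 hr').le) i j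
    have huniv := hclopen.eq_univ ⟨0, 0, fun i j => (hzero i j).le⟩
    intro r
    have : r ∈ {r : ℝ≥0 | ∃ C : ℝ≥0, ∀ i j, γ i j r ≤ C} := by rw [huniv]; trivial
    exact this
  have hwd : ∀ s : ℕ → ℝ≥0, MemLinfPlus s → ∃ C : ℝ≥0, ∀ i j, γ i j (s j) ≤ C := by
    rintro s ⟨R, hR⟩
    obtain ⟨C, hC⟩ := hbdd R
    exact ⟨C, fun i j => (hmono i j (hR (mem_range_self j))).trans (hC i j)⟩
  have hbd : ∀ s : ℕ → ℝ≥0, MemLinfPlus s →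
      ∀ i : ℕ, BddAbove (range fun j : ℕ => γ i j (s j)) := by
    intro s hs i
    obtain ⟨C, hC⟩ := hwd s hs
    exact ⟨C, by rintro _ ⟨j, rfl⟩; exact hC i j⟩
  refine ⟨fun s hs => ⟨hbd s hs, ?_⟩, ?_⟩
  · obtain ⟨C, hC⟩ := hwd s hs
    exact ⟨C, by rintro _ ⟨i, rfl⟩; exact ciSup_le (hC i)⟩
  · intro s hs ε hε
    obtain ⟨R, hR⟩ := id hs
    have hε2 : 0 < ε / 2 := half_pos hε
    choose d hd hdd using fun r => hequi r (ε / 2) hε2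
    obtain ⟨η, hη, hL⟩ := lebesgue_number_lemma_of_metric (s := Icc (0 : ℝ≥0) R)
      (c := fun r : ℝ≥0 => Metric.ball r (d r : ℝ)) isCompact_Icc
      (fun _ => Metric.isOpen_ball)
      (fun x _ => mem_iUnion.2 ⟨x, Metric.mem_ball_self (by exact_mod_cast hd x)⟩)
    have hη2 : 0 < η / 2 := half_pos hη
    refine ⟨⟨η / 2, hη2.le⟩, hη2, ?_⟩
    intro s' hs' hss i
    have key : ∀ j, dist (γ i j (s j)) (γ i j (s' j)) ≤ (ε : ℝ) := by
      intro j
      obtain ⟨c, hc⟩ := hL (s j) ⟨zero_le, hR (mem_range_self j)⟩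
      have h1 : dist (s j) c < d c := hc (Metric.mem_ball_self hη)
      have h2 : dist (s' j) c < d c := hc (by
        have : dist (s j) (s' j) ≤ η / 2 := hss j
        rw [Metric.mem_ball, dist_comm]; linarith)
      rw [dist_comm] at h1 h2
      have e1 := hdd c _ h1.le i j
      have e2 := hdd c _ h2.le i j
      have e3 := dist_triangle_left (γ i j (s j)) (γ i j (s' j)) (γ i j c)
      push_cast at e1 e2
      linarith
    have comp : ∀ u v : ℕ → ℝ≥0, MemLinfPlus v →
        (∀ j, dist (γ i j (u j)) (γ i j (v j)) ≤ (ε : ℝ)) →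
        gainOp γ u i ≤ gainOp γ v i + ε := by
      intro u v hv huv
      refine ciSup_le fun j => ?_
      have h1 : γ i j (v j) ≤ gainOp γ v i := le_ciSup (hbd v hv i) j
      have h2 := huv j
      rw [NNReal.dist_eq, abs_le] at h2
      rw [← NNReal.coe_le_coe] at h1 ⊢
      push_cast
      linarith [h2.2]
    have h1 := comp s s' hs' key
    have h2 := comp s' s hs (fun j => by rw [dist_comm]; exact key j)
    rw [← NNReal.coe_le_coe] at h1 h2
    push_cast at h1 h2
    rw [NNReal.dist_eq, abs_le]
    constructor <;> linarith
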